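/- Let 𝐌=(M_1,…,M_k) be a positively irreducible tuple of nonnegative d×d matrices which is normalized, i.e. r(𝐌)=1. Then the following three statements are equivalent: (1) there exists c>0 such that ‖M_J‖ ≥ c for every nonempty word J with M_J≠0; (2) there exists c>0 such that ‖M_J‖ ≤ c for every nonempty word J with M_J≠0; (3) there exists C>0 such that C⁻¹ ≤ ‖M_J‖ ≤ C for every nonempty word J with M_J≠0. -/

import Mathlib

open Filter Real MeasureTheory

/-- The matrix norm `‖A‖ = ∑_{i,j} |A i j|`. -/
noncomputable def mnorm {d : ℕ} (A : Matrix (Fin d) (Fin d) ℝ) : ℝ :=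
  ∑ i, ∑ j, |A i j|

/-- The product `M_{j₁} ⋯ M_{jₙ}` along a word `w = j₁⋯jₙ`. -/
noncomputable def wordProd {d k : ℕ} (M : Fin k → Matrix (Fin d) (Fin d) ℝ)
    (w : List (Fin k)) : Matrix (Fin d) (Fin d) ℝ :=
  (w.map M).prod

/-- `𝐌` has a uniform Lyapunov exponent modulo 0. -/
def HasULE {d k : ℕ} (M : Fin k → Matrix (Fin d) (Fin d) ℝ) : Prop :=
  ∃ C : ℝ, 0 < C ∧ ∃ lam : ℝ, ∀ w : List (Fin k), w ≠ [] →
    wordProd M w = 0 ∨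
      (C⁻¹ * Real.exp (lam * w.length) ≤ mnorm (wordProd M w) ∧
        mnorm (wordProd M w) ≤ C * Real.exp (lam * w.length))

/-- `𝐌` is irreducible: no nonzero proper subspace is invariant under all `M i`. -/
def MatIrred {d k : ℕ} (M : Fin k → Matrix (Fin d) (Fin d) ℝ) : Prop :=
  ∀ V : Submodule ℝ (Fin d → ℝ),
    (∀ i, ∀ v ∈ V, (M i).mulVec v ∈ V) → V = ⊥ ∨ V = ⊤

/-- `𝐌` is positively irreducible. -/
def PosIrred {d k : ℕ} (M : Fin k → Matrix (Fin d) (Fin d) ℝ) : Prop :=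
  (∀ i a b, 0 ≤ M i a b) ∧
    ∃ ℓ : ℕ, 1 ≤ ℓ ∧ ∀ a b, 0 < (∑ j ∈ Finset.Icc 1 ℓ, (∑ i, M i) ^ j) a b

/-- A single nonnegative matrix is positively irreducible:
some partial sum of its powers is entrywise positive. -/
def PosIrredMat {n : ℕ} (A : Matrix (Fin n) (Fin n) ℝ) : Prop :=
  ∃ ℓ : ℕ, 1 ≤ ℓ ∧ ∀ a b, 0 < (∑ j ∈ Finset.Icc 1 ℓ, A ^ j) a b

section WordSum

variable {α β : Type*} [Fintype α]

/-- The sum of `h` over all words of length `n`. -/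
def wordSum [AddCommMonoid β] : (List α → β) → ℕ → β
  | h, 0 => h []
  | h, n + 1 => ∑ i, wordSum (fun x => h (i :: x)) n

theorem wordSum_add_length [AddCommMonoid β] (h : List α → β) (n m : ℕ) :
    wordSum h (n + m) = wordSum (fun x => wordSum (fun y => h (x ++ y)) m) n := by
  induction n generalizing h with
  | zero => simp [wordSum]
  | succ n ih =>
    rw [Nat.succ_add]
    simp only [wordSum, ih, List.cons_append]

theorem wordSum_eq_sum_ofFn [AddCommMonoid β] (h : List α → β) (n : ℕ) :
    wordSum h n = ∑ x : Fin n → α, h (List.ofFn x) := by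
  induction n generalizing h with
  | zero => simp [wordSum]
  | succ n ih =>
    simp only [wordSum, ih]
    rw [← (Fin.consEquiv fun _ => α).sum_comp, Fintype.sum_prod_type]
    simp [Fin.consEquiv, List.ofFn_succ]

theorem map_wordSum {γ : Type*} [AddCommMonoid β] [AddCommMonoid γ] (φ : β →+ γ)
    (h : List α → β) (n : ℕ) : φ (wordSum h n) = wordSum (fun x => φ (h x)) n := by
  simp [wordSum_eq_sum_ofFn]

theorem wordSum_mono {h h' : List α → ℝ} {n : ℕ}
    (H : ∀ x, x.length = n → h x ≤ h' x) : wordSum h n ≤ wordSum h' n := by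
  simp only [wordSum_eq_sum_ofFn]
  exact Finset.sum_le_sum fun x _ => H _ (by simp)

theorem wordSum_nonneg {h : List α → ℝ} (H : ∀ x, 0 ≤ h x) (n : ℕ) : 0 ≤ wordSum h n := by
  simp only [wordSum_eq_sum_ofFn]
  exact Finset.sum_nonneg fun x _ => H _

theorem wordSum_const_mul (h : List α → ℝ) (a : ℝ) (n : ℕ) :
    wordSum (fun x => a * h x) n = a * wordSum h n := by
  simp only [wordSum_eq_sum_ofFn, Finset.mul_sum]

theorem wordSum_mul_const (h : List α → ℝ) (a : ℝ) (n : ℕ) :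
    wordSum (fun x => h x * a) n = wordSum h n * a := by
  simp only [wordSum_eq_sum_ofFn, Finset.sum_mul]

theorem wordSum_finset_sum {ι : Type*} (T : Finset ι) (h : ι → List α → ℝ) (n : ℕ) :
    wordSum (fun x => ∑ j ∈ T, h j x) n = ∑ j ∈ T, wordSum (h j) n := by
  simp only [wordSum_eq_sum_ofFn]
  exact Finset.sum_comm

theorem le_wordSum_length {h : List α → ℝ} (H : ∀ x, 0 ≤ h x) (x : List α) :
    h x ≤ wordSum h x.length := by
  rw [wordSum_eq_sum_ofFn]
  have := Finset.single_le_sum (f := fun y : Fin x.length → α => h (List.ofFn y))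
    (fun y _ => H _) (Finset.mem_univ x.get)
  simpa using this

theorem exists_pos_of_wordSum_pos {h : List α → ℝ} {n : ℕ} (H : 0 < wordSum h n) :
    ∃ x : List α, x.length = n ∧ 0 < h x := by
  rw [wordSum_eq_sum_ofFn] at H
  obtain ⟨x, -, hx⟩ := Finset.exists_lt_of_sum_lt (f := fun _ => (0 : ℝ)) (by simpa using H)
  exact ⟨_, by simp, hx⟩

/-- A nonnegative submultiplicative function on words which is supermultiplicative up to
inserting a connecting word of bounded length. -/
structure QuasiMul (f : List α → ℝ) : Prop where
  nonneg : ∀ w, 0 ≤ f w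
  append_le : ∀ u w, f (u ++ w) ≤ f u * f w
  exists_le_sum : ∃ c : ℝ, 0 < c ∧ ∃ T : Finset ℕ, ∀ u w,
    c * (f u * f w) ≤ ∑ j ∈ T, wordSum (fun x => f (u ++ (x ++ w))) j

theorem Subadditive.mul_le_of_tendsto {v : ℕ → ℝ} (hv : Subadditive v) {l : ℝ}
    (hl : Tendsto (fun n : ℕ => (n : ℝ)⁻¹ * v n) atTop (nhds l)) (n : ℕ) : l * n ≤ v n := by
  have hl' : Tendsto (fun n : ℕ => v n / n) atTop (nhds l) := by
    simpa only [div_eq_inv_mul] using hl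
  rcases Nat.eq_zero_or_pos n with rfl | hn
  · have := hv 0 0
    simp only [add_zero] at this
    simp only [CharP.cast_eq_zero, mul_zero]
    linarith
  · have hb := hl'.bddBelow_range
    have hlim := tendsto_nhds_unique (hv.tendsto_lim hb) hl'
    have := hv.lim_le_div hb hn.ne'
    rw [hlim, le_div_iff₀ (by exact_mod_cast hn)] at this
    exact this

namespace QuasiMul

variable {f : List α → ℝ}

theorem wordSum_append_le (hf : QuasiMul f) (w : List α) (n m : ℕ) :
    wordSum (fun x => f (w ++ x)) (n + m) ≤ wordSum (fun x => f (w ++ x)) n * wordSum f m := by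
  rw [wordSum_add_length, ← wordSum_mul_const]
  refine wordSum_mono fun x _ => ?_
  rw [← wordSum_const_mul]
  refine wordSum_mono fun y _ => ?_
  rw [← List.append_assoc]
  exact hf.append_le _ _

theorem wordSum_add_le (hf : QuasiMul f) (n m : ℕ) :
    wordSum f (n + m) ≤ wordSum f n * wordSum f m := by
  simpa using hf.wordSum_append_le [] n m

/-- Extending `w` by words of length `n` costs at most a constant compared with the product. -/
theorem exists_mul_wordSum_le (hf : QuasiMul f) : ∃ C : ℝ, 0 < C ∧ ∀ w n,
    f w * wordSum f n ≤ C * wordSum (fun x => f (w ++ x)) n := by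
  obtain ⟨c, hc, T, hT⟩ := hf.exists_le_sum
  refine ⟨(∑ j ∈ T, wordSum f j + 1) / c, ?_, fun w n => ?_⟩
  · have : 0 ≤ ∑ j ∈ T, wordSum f j :=
      Finset.sum_nonneg fun j _ => wordSum_nonneg hf.nonneg j
    positivity
  have h1 := wordSum_mono (n := n) fun x _ => hT w x
  rw [wordSum_const_mul, wordSum_const_mul, wordSum_finset_sum] at h1
  have h2 : ∀ j, wordSum (fun x => wordSum (fun y => f (w ++ (y ++ x))) j) n
      ≤ wordSum (fun x => f (w ++ x)) n * wordSum f j := by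
    intro j
    have : wordSum (fun x => wordSum (fun y => f (w ++ (y ++ x))) j) n
        = wordSum (fun x => f (w ++ x)) (j + n) := by
      rw [wordSum_add_length]
      simp only [wordSum_eq_sum_ofFn]
      exact Finset.sum_comm
    rw [this, add_comm]
    exact hf.wordSum_append_le w n j
  have h3 := h1.trans (Finset.sum_le_sum fun j _ => h2 j)
  rw [← Finset.mul_sum] at h3
  have h4 := wordSum_nonneg (fun x => hf.nonneg (w ++ x)) n
  rw [div_mul_eq_mul_div, le_div_iff₀ hc]
  nlinarith

theorem exists_mul_le_wordSum_add (hf : QuasiMul f) : ∃ C : ℝ, 0 < C ∧ ∀ n m,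
    wordSum f n * wordSum f m ≤ C * wordSum f (n + m) := by
  obtain ⟨C, hC, h⟩ := hf.exists_mul_wordSum_le
  refine ⟨C, hC, fun n m => ?_⟩
  rw [wordSum_add_length, ← wordSum_mul_const, ← wordSum_const_mul]
  exact wordSum_mono fun x _ => h x m

theorem exists_wordSum_bounds (hf : QuasiMul f) (hpos : ∀ n, 0 < wordSum f n) {l : ℝ}
    (hl : Tendsto (fun n : ℕ => (n : ℝ)⁻¹ * log (wordSum f n)) atTop (nhds l)) :
    ∃ C : ℝ, 0 < C ∧ ∀ n, exp l ^ n ≤ wordSum f n ∧ wordSum f n ≤ C * exp l ^ n := by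
  obtain ⟨C, hC, h⟩ := hf.exists_mul_le_wordSum_add
  refine ⟨C, hC, fun n => ?_⟩
  have hexp : exp l ^ n = exp (l * n) := by rw [← exp_nat_mul, mul_comm]
  rw [hexp]
  constructor
  · have hs : Subadditive fun n => log (wordSum f n) := fun n m => by
      rw [← log_mul (hpos n).ne' (hpos m).ne']
      exact log_le_log (hpos _) (hf.wordSum_add_le n m)
    rw [← le_log_iff_exp_le (hpos n)]
    exact hs.mul_le_of_tendsto hl n
  · have hs : Subadditive fun n => log C - log (wordSum f n) := fun n m => by
      have := log_le_log (mul_pos (hpos n) (hpos m)) (h n m)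
      rw [log_mul (hpos n).ne' (hpos m).ne', log_mul hC.ne' (hpos _).ne'] at this
      linarith
    have hl' : Tendsto (fun n : ℕ => (n : ℝ)⁻¹ * (log C - log (wordSum f n))) atTop
        (nhds (-l)) := by
      have h0 : Tendsto (fun n : ℕ => (n : ℝ)⁻¹ * log C) atTop (nhds (0 * log C)) :=
        tendsto_inv_atTop_nhds_zero_nat.mul_const _
      simpa [mul_sub] using h0.sub hl
    have := hs.mul_le_of_tendsto hl' n
    rw [← log_le_log_iff (hpos n) (by positivity), log_mul hC.ne' (exp_pos _).ne', log_exp]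
    linarith

/-- Existence of a function comparable to `f` that is harmonic for the extension of words. -/
theorem exists_harmonic (hf : QuasiMul f) (hpos : ∀ n, 0 < wordSum f n) {l : ℝ}
    (hl : Tendsto (fun n : ℕ => (n : ℝ)⁻¹ * log (wordSum f n)) atTop (nhds l)) :
    ∃ a b : ℝ, 0 < a ∧ 0 < b ∧ ∃ Φ : List α → ℝ, (∀ w, a * f w ≤ Φ w ∧ Φ w ≤ b * f w) ∧
      ∀ w, ∑ i, Φ (w ++ [i]) = exp l * Φ w := by
  obtain ⟨b, hb, hS⟩ := hf.exists_wordSum_bounds hpos hl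
  obtain ⟨C, hC, hL⟩ := hf.exists_mul_wordSum_le
  set ρ := exp l
  have hρ : 0 < ρ := exp_pos l
  set F : List α → ℕ → ℝ := fun w n => (ρ ^ n)⁻¹ * wordSum (fun x => f (w ++ x)) n with hF
  have hFle : ∀ w n, C⁻¹ * f w ≤ F w n ∧ F w n ≤ b * f w := by
    intro w n
    have hp : 0 < ρ ^ n := pow_pos hρ n
    have h1 := hL w n
    have h2 := hf.wordSum_append_le w 0 n
    simp only [wordSum, List.append_nil, zero_add] at h2
    have h3 := hf.nonneg w
    simp only [hF]
    constructor
    · rw [inv_mul_eq_div, inv_mul_eq_div, div_le_div_iff₀ hC hp]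
      nlinarith [(hS n).1]
    · rw [inv_mul_eq_div, div_le_iff₀ hp]
      nlinarith [(hS n).2]
  have hFsucc : ∀ w n, ∑ i, F (w ++ [i]) n = ρ * F w (n + 1) := by
    intro w n
    simp only [hF, wordSum, ← Finset.mul_sum, List.append_assoc, List.singleton_append]
    field_simp
    ring
  set A : ℕ → List α → ℝ := fun N w => (N : ℝ)⁻¹ * ∑ n ∈ Finset.range N, F w n with hA
  have hAle : ∀ w, ∀ N : ℕ, N ≠ 0 → A N w ∈ Set.Icc (C⁻¹ * f w) (b * f w) := by
    intro w N hN
    have hN' : (0 : ℝ) < N := by positivity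
    have h1 := Finset.card_nsmul_le_sum (Finset.range N) (F w) _ fun n _ => (hFle w n).1
    have h2 := Finset.sum_le_card_nsmul (Finset.range N) (F w) _ fun n _ => (hFle w n).2
    simp only [Finset.card_range, nsmul_eq_mul] at h1 h2
    simp only [hA, Set.mem_Icc]
    rw [inv_mul_eq_div (N : ℝ), le_div_iff₀ hN', div_le_iff₀ hN']
    constructor <;> linarith
  have hU : (hyperfilter ℕ : Filter ℕ) ≤ atTop := Nat.hyperfilter_le_atTop
  have hlim : ∀ w, ∃ y ∈ Set.Icc (C⁻¹ * f w) (b * f w),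
      Tendsto (fun N => A N w) (hyperfilter ℕ) (nhds y) := by
    intro w
    refine isCompact_Icc.ultrafilter_le_nhds ((hyperfilter ℕ).map fun N => A N w) ?_
    rw [le_principal_iff]
    exact hU (eventually_atTop.2 ⟨1, fun N hN => hAle w N (by omega)⟩)
  choose Φ hΦ hΦlim using hlim
  refine ⟨C⁻¹, b, inv_pos.2 hC, hb, Φ, hΦ, fun w => ?_⟩
  have h1 : Tendsto (fun N => ∑ i, A N (w ++ [i])) (hyperfilter ℕ)
      (nhds (∑ i, Φ (w ++ [i]))) := tendsto_finsetSum _ fun i _ => hΦlim _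
  have h2 : ∀ N, ∑ i, A N (w ++ [i]) = ρ * (A N w + (N : ℝ)⁻¹ * (F w N - F w 0)) := by
    intro N
    simp only [hA]
    rw [← Finset.mul_sum, Finset.sum_comm]
    simp only [hFsucc]
    have := Finset.sum_range_sub (F w) N
    rw [Finset.sum_sub_distrib] at this
    rw [← Finset.mul_sum, ← this]
    ring
  have h3 : Tendsto (fun N : ℕ => (N : ℝ)⁻¹ * (F w N - F w 0)) atTop (nhds 0) := by
    refine tendsto_inv_atTop_nhds_zero_nat.zero_mul_isBoundedUnder_le ?_
    refine isBoundedUnder_of ⟨b * f w, fun N => ?_⟩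
    have h0 := hFle w 0
    have hN := hFle w N
    have := mul_nonneg (inv_pos.2 hC).le (hf.nonneg w)
    simp only [Function.comp, Real.norm_eq_abs, abs_le]
    constructor <;> linarith
  have h4 : Tendsto (fun N => ∑ i, A N (w ++ [i])) (hyperfilter ℕ) (nhds (ρ * (Φ w + 0))) := by
    simp only [h2]
    exact ((hΦlim w).add (h3.mono_left hU)).const_mul ρ
  rw [tendsto_nhds_unique h1 h4, add_zero]

/-- The support of a quasi-multiplicative function. -/
theorem indicator (hf : QuasiMul f) : QuasiMul fun w => if f w = 0 then (0 : ℝ) else 1 := by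
  have hnn : ∀ w, (0 : ℝ) ≤ if f w = 0 then 0 else 1 := fun w => by split_ifs <;> norm_num
  refine ⟨hnn, fun u w => ?_, ?_⟩
  · by_cases h : f (u ++ w) = 0
    · rw [if_pos h]
      exact mul_nonneg (hnn u) (hnn w)
    · have h1 := hf.append_le u w
      have hu : f u ≠ 0 := fun h0 => h (le_antisymm (by simpa [h0] using h1) (hf.nonneg _))
      have hw : f w ≠ 0 := fun h0 => h (le_antisymm (by simpa [h0] using h1) (hf.nonneg _))
      simp [h, hu, hw]
  · obtain ⟨c, hc, T, hT⟩ := hf.exists_le_sum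
    refine ⟨1, one_pos, T, fun u w => ?_⟩
    have hs : ∀ j ∈ T, 0 ≤ wordSum (fun x => if f (u ++ (x ++ w)) = 0 then (0 : ℝ) else 1) j :=
      fun j _ => wordSum_nonneg (fun x => hnn _) j
    by_cases hu : f u = 0
    · simpa [hu] using Finset.sum_nonneg hs
    by_cases hw : f w = 0
    · simpa [hw] using Finset.sum_nonneg hs
    have hp : 0 < c * (f u * f w) :=
      mul_pos hc (mul_pos ((hf.nonneg u).lt_of_ne' hu) ((hf.nonneg w).lt_of_ne' hw))
    obtain ⟨j, hj, hjp⟩ := Finset.exists_lt_of_sum_lt (f := fun _ => (0 : ℝ))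
      (by simpa using hp.trans_le (hT u w))
    obtain ⟨x, rfl, hx⟩ := exists_pos_of_wordSum_pos hjp
    have h1 := le_wordSum_length
      (h := fun x => if f (u ++ (x ++ w)) = 0 then (0 : ℝ) else 1) (fun x => hnn _) x
    have h2 := Finset.single_le_sum hs hj
    simp only [hx.ne', if_false] at h1
    simp only [hu, hw, if_false]
    linarith

theorem wordSum_indicator_pos (hf : QuasiMul f) (hpos : ∀ n, 0 < wordSum f n) (n : ℕ) :
    0 < wordSum (fun w => if f w = 0 then (0 : ℝ) else 1) n := by
  obtain ⟨x, rfl, hx⟩ := exists_pos_of_wordSum_pos (hpos n)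
  have := le_wordSum_length (h := fun w => if f w = 0 then (0 : ℝ) else 1) hf.indicator.nonneg x
  simp only [hx.ne', if_false] at this
  linarith

theorem wordSum_pos_of_tendsto_rpow (hf : QuasiMul f) {ρ : ℝ} (hρ : 0 < ρ)
    (h : Tendsto (fun n : ℕ => wordSum f n ^ (n : ℝ)⁻¹) atTop (nhds ρ)) (n : ℕ) :
    0 < wordSum f n := by
  refine (wordSum_nonneg hf.nonneg n).lt_of_ne' fun hn => hρ.ne' ?_
  refine tendsto_nhds_unique h (tendsto_const_nhds.congr' ?_)
  filter_upwards [eventually_ge_atTop (n + 1)] with m hm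
  have h0 : wordSum f m = 0 := by
    obtain ⟨r, rfl⟩ := Nat.exists_eq_add_of_le (Nat.le_of_succ_le hm)
    refine le_antisymm ?_ (wordSum_nonneg hf.nonneg _)
    simpa [hn] using hf.wordSum_add_le n r
  have hm0 : (m : ℝ)⁻¹ ≠ 0 := inv_ne_zero (by exact_mod_cast (by omega : m ≠ 0))
  rw [h0, zero_rpow hm0]

end QuasiMul

theorem wordSum_harmonic {D : List α → ℝ} {ρ : ℝ} (hD : ∀ w, ∑ i, D (w ++ [i]) = ρ * D w)
    (w : List α) (n : ℕ) : wordSum (fun x => D (w ++ x)) n = ρ ^ n * D w := by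
  induction n generalizing w with
  | zero => simp [wordSum]
  | succ n ih =>
    have : ∀ i, wordSum (fun x => D (w ++ i :: x)) n = ρ ^ n * D (w ++ [i]) := fun i => by
      simpa using ih (w ++ [i])
    simp only [wordSum, this, ← Finset.mul_sum, hD]
    ring

theorem harmonic_append_le {D : List α → ℝ} {ρ : ℝ} (hD : ∀ w, ∑ i, D (w ++ [i]) = ρ * D w)
    (hnn : ∀ w, 0 ≤ D w) (w x : List α) : D (w ++ x) ≤ ρ ^ x.length * D w := by
  rw [← wordSum_harmonic hD]
  exact le_wordSum_length (h := fun x => D (w ++ x)) (fun _ => hnn _) x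

/-- For harmonic `V` and `Φ`, a point where `V / Φ` is nearly minimal has `V / Φ` nearly minimal
at all of its extensions of bounded length. -/
theorem exists_nearly_minimal {V Φ : List α → ℝ} {ρ B : ℝ} (hρ : 0 < ρ) (hB : 0 < B)
    (hV : ∀ w, ∑ i, V (w ++ [i]) = ρ * V w) (hΦ : ∀ w, ∑ i, Φ (w ++ [i]) = ρ * Φ w)
    (hV0 : ∀ w, 0 ≤ V w) (hΦ0 : ∀ w, 0 ≤ Φ w) (hΦB : ∀ w, Φ w ≤ B) (hne : ∃ w, 0 < Φ w) :
    ∃ m : ℝ, 0 ≤ m ∧ ∀ (N : ℕ) (η : ℝ), 0 < η → ∃ w, 0 < Φ w ∧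
      ∀ x : List α, x.length ≤ N → V (w ++ x) ≤ m * Φ (w ++ x) + η := by
  set S : Set ℝ := {t | ∀ w, t * Φ w ≤ V w} with hS
  have h0 : (0 : ℝ) ∈ S := fun w => by simpa using hV0 w
  have hle : ∀ w, 0 < Φ w → ∀ t ∈ S, t ≤ V w / Φ w := fun w hw t ht =>
    (le_div_iff₀ hw).2 (ht w)
  obtain ⟨w₀, hw₀⟩ := hne
  have hbdd : BddAbove S := ⟨V w₀ / Φ w₀, hle w₀ hw₀⟩
  have hm : ∀ w, sSup S * Φ w ≤ V w := fun w => by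
    rcases (hΦ0 w).eq_or_lt with h | h
    · simpa [← h] using hV0 w
    · exact (le_div_iff₀ h).1 (csSup_le ⟨0, h0⟩ (hle w h))
  refine ⟨sSup S, le_csSup hbdd h0, fun N η hη => ?_⟩
  set R := max 1 ρ ^ N
  have hRpos : 0 < R := by positivity
  set δ := η / (R * B) with hδ
  have hδpos : 0 < δ := by positivity
  have hnot : sSup S + δ ∉ S := fun h => by
    have := le_csSup hbdd h
    linarith
  simp only [hS, Set.mem_ofPred_eq, not_forall, not_le] at hnot
  obtain ⟨w, hw⟩ := hnot
  have hmw := hm w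
  refine ⟨w, (hΦ0 w).lt_of_ne' fun h => ?_, fun x hx => ?_⟩
  · rw [h] at hw hmw
    linarith
  have h1 := harmonic_append_le (D := fun w => V w - sSup S * Φ w) (ρ := ρ)
    (fun w => by
      rw [Finset.sum_sub_distrib, ← Finset.mul_sum, hV, hΦ]
      ring) (fun w => sub_nonneg.2 (hm w)) w x
  have h2 : ρ ^ x.length ≤ R :=
    (pow_le_pow_left₀ hρ.le (le_max_right _ _) _).trans
      (pow_le_pow_right₀ (le_max_left _ _) hx)
  have h3 : V w - sSup S * Φ w ≤ δ * B := by
    nlinarith [mul_le_mul_of_nonneg_left (hΦB w) hδpos.le]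
  have h4 := mul_le_mul h2 h3 (sub_nonneg.2 hmw) hRpos.le
  have h5 : R * (δ * B) = η := by
    rw [hδ]
    field_simp
  linarith

namespace QuasiMul

variable {f : List α → ℝ}

theorem bounded_of_bounded_below (hf : QuasiMul f) (hpos : ∀ n, 0 < wordSum f n)
    {l : ℝ} (hl : Tendsto (fun n : ℕ => (n : ℝ)⁻¹ * log (wordSum f n)) atTop (nhds l))
    (hlg : Tendsto (fun n : ℕ => (n : ℝ)⁻¹ *
      log (wordSum (fun w => if f w = 0 then (0 : ℝ) else 1) n)) atTop (nhds l))
    {c : ℝ} (hc : 0 < c) (hlow : ∀ w, f w ≠ 0 → c ≤ f w) : ∃ C : ℝ, 0 < C ∧ ∀ w, f w ≤ C := by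
  obtain ⟨a, b, ha, hb, V, hV, hVh⟩ := hf.exists_harmonic hpos hl
  obtain ⟨a', b', ha', hb', Φ, hΦ, hΦh⟩ :=
    hf.indicator.exists_harmonic (hf.wordSum_indicator_pos hpos) hlg
  obtain ⟨κ, hκ, T, hT⟩ := hf.exists_le_sum
  have hΦ0 : ∀ w, 0 ≤ Φ w := fun w =>
    (mul_nonneg ha'.le (hf.indicator.nonneg w)).trans (hΦ w).1
  have hΦb : ∀ w, Φ w ≤ b' := fun w => (hΦ w).2.trans <| by
    split_ifs <;> simp [hb'.le]
  have hf0 : 0 < f [] := hpos 0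
  obtain ⟨m, hm, hmin⟩ := exists_nearly_minimal (exp_pos l) hb' hVh hΦh
    (fun w => (mul_nonneg ha.le (hf.nonneg w)).trans (hV w).1) hΦ0 hΦb
    ⟨[], (by simpa [hf0.ne'] using ha' : (0 : ℝ) < a' * _).trans_le (hΦ []).1⟩
  set B := (m * b' + 1) / a with hB
  set E := ∑ j ∈ T, wordSum (fun _ : List α => B) j
  have hB0 : 0 ≤ B := by positivity
  have hE0 : 0 ≤ E := Finset.sum_nonneg fun j _ => wordSum_nonneg (fun _ => hB0) j
  refine ⟨E / (κ * c) + 1, by positivity, fun J => ?_⟩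
  obtain ⟨w, hw, hx⟩ := hmin (T.sup id + J.length) 1 one_pos
  have hfw : f w ≠ 0 := fun h => by
    have := (hΦ w).2
    simp only [h, if_true, mul_zero] at this
    linarith
  have hbd : ∀ j ∈ T, ∀ x : List α, x.length = j → f (w ++ (x ++ J)) ≤ B := by
    intro j hj x hxj
    have h1 := hx (x ++ J) (by
      have : j ≤ T.sup id := Finset.le_sup (f := id) hj
      simp only [List.length_append]
      omega)
    rw [hB, le_div_iff₀ ha]
    have h2 := (hV (w ++ (x ++ J))).1
    have h3 := mul_le_mul_of_nonneg_left (hΦb (w ++ (x ++ J))) hm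
    linarith
  have h1 := (hT w J).trans (Finset.sum_le_sum fun j hj => wordSum_mono (hbd j hj))
  have h2 : κ * (c * f J) ≤ E :=
    (mul_le_mul_of_nonneg_left (mul_le_mul_of_nonneg_right (hlow w hfw) (hf.nonneg J))
      hκ.le).trans h1
  have h3 : f J ≤ E / (κ * c) := by
    rw [le_div_iff₀ (by positivity)]
    linarith
  linarith

theorem bounded_below_of_bounded (hf : QuasiMul f) (hpos : ∀ n, 0 < wordSum f n)
    {l : ℝ} (hl : Tendsto (fun n : ℕ => (n : ℝ)⁻¹ * log (wordSum f n)) atTop (nhds l))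
    (hlg : Tendsto (fun n : ℕ => (n : ℝ)⁻¹ *
      log (wordSum (fun w => if f w = 0 then (0 : ℝ) else 1) n)) atTop (nhds l))
    {C : ℝ} (hC : 0 < C) (hup : ∀ w, f w ≤ C) : ∃ c : ℝ, 0 < c ∧ ∀ w, f w ≠ 0 → c ≤ f w := by
  obtain ⟨a, b, ha, hb, V, hV, hVh⟩ := hf.exists_harmonic hpos hl
  obtain ⟨a', b', ha', hb', Φ, hΦ, hΦh⟩ :=
    hf.indicator.exists_harmonic (hf.wordSum_indicator_pos hpos) hlg
  obtain ⟨κ, hκ, T, hT⟩ := hf.exists_le_sum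
  have hf0 : 0 < f [] := hpos 0
  obtain ⟨m, hm, hmin⟩ := exists_nearly_minimal (exp_pos l) (mul_pos hb hC) hΦh hVh
    (fun w => (mul_nonneg ha'.le (hf.indicator.nonneg w)).trans (hΦ w).1)
    (fun w => (mul_nonneg ha.le (hf.nonneg w)).trans (hV w).1)
    (fun w => (hV w).2.trans (mul_le_mul_of_nonneg_left (hup w) hb.le))
    ⟨[], (mul_pos ha hf0).trans_le (hV []).1⟩
  refine ⟨a' / 2 / (m * b * C ^ 2 + 1), by positivity, fun J hJ => ?_⟩
  obtain ⟨w, hw, hx⟩ := hmin (T.sup id + J.length) (a' / 2) (by positivity)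
  have hfw : 0 < f w := (hf.nonneg w).lt_of_ne' fun h => by
    have := (hV w).2
    simp only [h, mul_zero] at this
    linarith
  have hfJ : 0 < f J := (hf.nonneg J).lt_of_ne' hJ
  obtain ⟨j, hj, hjp⟩ := Finset.exists_lt_of_sum_lt (f := fun _ => (0 : ℝ))
    (by simpa using (by positivity : 0 < κ * (f w * f J)).trans_le (hT w J))
  obtain ⟨x, rfl, hxp⟩ := exists_pos_of_wordSum_pos hjp
  have h1 := hx (x ++ J) (by
    have : x.length ≤ T.sup id := Finset.le_sup (f := id) hj
    simp only [List.length_append]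
    omega)
  have h2 := (hΦ (w ++ (x ++ J))).1
  simp only [hxp.ne', if_false, mul_one] at h2
  have h3 : f (w ++ (x ++ J)) ≤ C ^ 2 * f J := calc
    f (w ++ (x ++ J)) ≤ f w * (f x * f J) :=
      (hf.append_le _ _).trans (mul_le_mul_of_nonneg_left (hf.append_le _ _) hfw.le)
    _ ≤ C * (C * f J) := mul_le_mul (hup w) (mul_le_mul_of_nonneg_right (hup x) hfJ.le)
      (mul_nonneg (hf.nonneg x) hfJ.le) hC.le
    _ = C ^ 2 * f J := by ring
  have h4 := mul_le_mul_of_nonneg_left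
    ((hV (w ++ (x ++ J))).2.trans (mul_le_mul_of_nonneg_left h3 hb.le)) hm
  rw [div_le_iff₀ (by positivity)]
  nlinarith

end QuasiMul

end WordSum

section Matrices

variable {d k : ℕ}

theorem mnorm_nonneg (A : Matrix (Fin d) (Fin d) ℝ) : 0 ≤ mnorm A :=
  Finset.sum_nonneg fun _ _ => Finset.sum_nonneg fun _ _ => abs_nonneg _

theorem mnorm_eq_zero {A : Matrix (Fin d) (Fin d) ℝ} : mnorm A = 0 ↔ A = 0 := by
  refine ⟨fun h => ?_, fun h => by simp [h, mnorm]⟩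
  ext i j
  have h1 := (Finset.sum_eq_zero_iff_of_nonneg
    fun i _ => Finset.sum_nonneg fun j _ => abs_nonneg (A i j)).1 h i (Finset.mem_univ i)
  have h2 := (Finset.sum_eq_zero_iff_of_nonneg
    fun j _ => abs_nonneg (A i j)).1 h1 j (Finset.mem_univ j)
  simpa using h2

theorem mnorm_mul_le (A B : Matrix (Fin d) (Fin d) ℝ) : mnorm (A * B) ≤ mnorm A * mnorm B := by
  have h1 : ∀ i j, |(A * B) i j| ≤ ∑ a, |A i a| * |B a j| := fun i j => by
    rw [Matrix.mul_apply]
    refine (Finset.abs_sum_le_sum_abs _ _).trans_eq ?_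
    simp only [abs_mul]
  have h2 : ∀ i a, |A i a| * ∑ j, |B a j| ≤ |A i a| * mnorm B := fun i a =>
    mul_le_mul_of_nonneg_left (Finset.single_le_sum (f := fun a => ∑ j, |B a j|)
      (fun _ _ => Finset.sum_nonneg fun _ _ => abs_nonneg _) (Finset.mem_univ a)) (abs_nonneg _)
  calc mnorm (A * B) ≤ ∑ i, ∑ j, ∑ a, |A i a| * |B a j| :=
        Finset.sum_le_sum fun i _ => Finset.sum_le_sum fun j _ => h1 i j
    _ = ∑ i, ∑ a, |A i a| * ∑ j, |B a j| := by
        refine Finset.sum_congr rfl fun i _ => ?_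
        rw [Finset.sum_comm]
        simp only [Finset.mul_sum]
    _ ≤ ∑ i, ∑ a, |A i a| * mnorm B :=
        Finset.sum_le_sum fun i _ => Finset.sum_le_sum fun a _ => h2 i a
    _ = mnorm A * mnorm B := by simp only [mnorm, Finset.sum_mul]

/-- The sum of all entries, which is `mnorm` on nonnegative matrices. -/
def entrySum : Matrix (Fin d) (Fin d) ℝ →+ ℝ where
  toFun A := ∑ i, ∑ j, A i j
  map_zero' := by simp
  map_add' A B := by simp [Finset.sum_add_distrib]

theorem mnorm_eq_entrySum {A : Matrix (Fin d) (Fin d) ℝ} (hA : ∀ i j, 0 ≤ A i j) :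
    mnorm A = entrySum A := by
  simp [mnorm, entrySum, abs_of_nonneg, hA]

theorem entrySum_mul_mul_ge {A P B : Matrix (Fin d) (Fin d) ℝ} {κ : ℝ}
    (hA : ∀ i j, 0 ≤ A i j) (hB : ∀ i j, 0 ≤ B i j) (hP : ∀ i j, κ ≤ P i j) :
    κ * (entrySum A * entrySum B) ≤ entrySum (A * (P * B)) := by
  have h : entrySum (A * (P * B)) = ∑ i, ∑ a, ∑ b, ∑ j, A i a * (P a b * B b j) := by
    simp only [entrySum, AddMonoidHom.coe_mk, ZeroHom.coe_mk, Matrix.mul_apply, Finset.mul_sum]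
    refine Finset.sum_congr rfl fun i _ => ?_
    rw [Finset.sum_comm]
    refine Finset.sum_congr rfl fun a _ => ?_
    rw [Finset.sum_comm]
  have h' : κ * (entrySum A * entrySum B) = ∑ i, ∑ a, ∑ b, ∑ j, A i a * (κ * B b j) := by
    rw [mul_left_comm]
    simp only [entrySum, AddMonoidHom.coe_mk, ZeroHom.coe_mk, Finset.sum_mul]
    simp only [Finset.mul_sum]
  rw [h, h']
  gcongr with i _ a _ b _ j _
  · exact hA i a
  · exact hB b j
  · exact hP a b

theorem wordProd_append (M : Fin k → Matrix (Fin d) (Fin d) ℝ) (u w : List (Fin k)) :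
    wordProd M (u ++ w) = wordProd M u * wordProd M w := by
  simp [wordProd]

theorem wordProd_nonneg {M : Fin k → Matrix (Fin d) (Fin d) ℝ} (hM : ∀ i a b, 0 ≤ M i a b)
    (w : List (Fin k)) (a b : Fin d) : 0 ≤ wordProd M w a b := by
  induction w generalizing a b with
  | nil =>
    simp only [wordProd, List.map_nil, List.prod_nil, Matrix.one_apply]
    split_ifs <;> norm_num
  | cons i w ih =>
    simp only [wordProd, List.map_cons, List.prod_cons, Matrix.mul_apply] at ih ⊢
    exact Finset.sum_nonneg fun c _ => mul_nonneg (hM i a c) (ih c b)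

theorem wordSum_wordProd (M : Fin k → Matrix (Fin d) (Fin d) ℝ) (n : ℕ) :
    wordSum (wordProd M) n = (∑ i, M i) ^ n := by
  induction n with
  | zero => simp [wordSum, wordProd]
  | succ n ih =>
    have : ∀ i, wordSum (fun x => wordProd M (i :: x)) n = M i * (∑ i, M i) ^ n := fun i => by
      rw [← ih]
      exact (map_wordSum (AddMonoidHom.mulLeft (M i)) (wordProd M) n).symm
    simp only [wordSum, this, ← Finset.sum_mul, pow_succ']

theorem wordSum_mnorm {M : Fin k → Matrix (Fin d) (Fin d) ℝ} (hM : ∀ i a b, 0 ≤ M i a b)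
    (n : ℕ) : wordSum (fun w => mnorm (wordProd M w)) n = mnorm ((∑ i, M i) ^ n) := by
  have hn : ∀ a b, 0 ≤ ((∑ i, M i) ^ n) a b := fun a b => by
    rw [← wordSum_wordProd, wordSum_eq_sum_ofFn, Matrix.sum_apply]
    exact Finset.sum_nonneg fun x _ => wordProd_nonneg hM _ a b
  rw [mnorm_eq_entrySum hn, ← wordSum_wordProd, map_wordSum]
  simp only [mnorm_eq_entrySum (wordProd_nonneg hM _)]

theorem quasiMul_mnorm [NeZero d] {M : Fin k → Matrix (Fin d) (Fin d) ℝ} (hM : PosIrred M) :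
    QuasiMul fun w => mnorm (wordProd M w) := by
  obtain ⟨hM, l, -, hl⟩ := hM
  refine ⟨fun w => mnorm_nonneg _, fun u w => ?_, ?_⟩
  · rw [wordProd_append]
    exact mnorm_mul_le _ _
  set P := ∑ j ∈ Finset.Icc 1 l, (∑ i, M i) ^ j with hP
  obtain ⟨p, hp⟩ := Finite.exists_min fun p : Fin d × Fin d => P p.1 p.2
  refine ⟨P p.1 p.2, hl _ _, Finset.Icc 1 l, fun u w => ?_⟩
  simp only [mnorm_eq_entrySum (wordProd_nonneg hM _)]
  refine (entrySum_mul_mul_ge (wordProd_nonneg hM u) (wordProd_nonneg hM w)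
    fun i j => hp (i, j)).trans_eq ?_
  rw [hP, Finset.sum_mul, Finset.mul_sum, map_sum]
  refine Finset.sum_congr rfl fun j _ => ?_
  rw [← wordSum_wordProd]
  simp only [wordProd_append]
  exact map_wordSum (entrySum.comp ((AddMonoidHom.mulLeft (wordProd M u)).comp
    (AddMonoidHom.mulRight (wordProd M w)))) (wordProd M) j

theorem wordSum_indicator_mnorm (M : Fin k → Matrix (Fin d) (Fin d) ℝ) (n : ℕ) :
    wordSum (fun w => if mnorm (wordProd M w) = 0 then (0 : ℝ) else 1) n =
      Set.ncard {f : Fin n → Fin k | wordProd M (List.ofFn f) ≠ 0} := by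
  classical
  rw [wordSum_eq_sum_ofFn, Set.ncard_eq_toFinset_card']
  simp [mnorm_eq_zero, Finset.sum_ite]

end Matrices

theorem stmt3 {d k : ℕ} [NeZero d] [NeZero k]
    (M : Fin k → Matrix (Fin d) (Fin d) ℝ)
    (hpos : PosIrred M)
    (entM rhoM : ℝ)
    (hent : Tendsto (fun n : ℕ =>
        (n : ℝ)⁻¹ * Real.log (Set.ncard {f : Fin n → Fin k | wordProd M (List.ofFn f) ≠ 0}))
      atTop (nhds entM))
    (hrho : Tendsto (fun n : ℕ => mnorm ((∑ i, M i) ^ n) ^ ((n : ℝ))⁻¹) atTop (nhds rhoM))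
    (hnormalized : rhoM / Real.exp entM = 1) :
    ((∃ c : ℝ, 0 < c ∧ ∀ w : List (Fin k), w ≠ [] → wordProd M w ≠ 0 →
        c ≤ mnorm (wordProd M w)) ↔
      (∃ c : ℝ, 0 < c ∧ ∀ w : List (Fin k), w ≠ [] → wordProd M w ≠ 0 →
        mnorm (wordProd M w) ≤ c)) ∧
    ((∃ c : ℝ, 0 < c ∧ ∀ w : List (Fin k), w ≠ [] → wordProd M w ≠ 0 →
        mnorm (wordProd M w) ≤ c) ↔
      (∃ C : ℝ, 0 < C ∧ ∀ w : List (Fin k), w ≠ [] → wordProd M w ≠ 0 →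
        C⁻¹ ≤ mnorm (wordProd M w) ∧ mnorm (wordProd M w) ≤ C)) := by
  have hf := quasiMul_mnorm hpos
  have hrho' : rhoM = exp entM := (div_eq_one_iff_eq (exp_pos _).ne').1 hnormalized
  subst hrho'
  simp only [← wordSum_indicator_mnorm] at hent
  simp only [← wordSum_mnorm hpos.1] at hrho
  have hS := hf.wordSum_pos_of_tendsto_rpow (exp_pos _) hrho
  have hl : Tendsto (fun n : ℕ =>
      (n : ℝ)⁻¹ * log (wordSum (fun w => mnorm (wordProd M w)) n)) atTop (nhds entM) := by
    have := ((continuousAt_log (exp_pos entM).ne').tendsto.comp hrho)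
    rw [log_exp] at this
    exact this.congr fun n => log_rpow (hS n) _
  have hnil : 0 < mnorm (wordProd M []) := hS 0
  have up : (∃ c : ℝ, 0 < c ∧ ∀ w : List (Fin k), w ≠ [] → wordProd M w ≠ 0 →
      c ≤ mnorm (wordProd M w)) → ∃ C : ℝ, 0 < C ∧ ∀ w, mnorm (wordProd M w) ≤ C := by
    rintro ⟨c, hc, h⟩
    refine hf.bounded_of_bounded_below hS hl hent (lt_min hc hnil) fun w hw => ?_
    by_cases hw0 : w = []
    · exact hw0 ▸ min_le_right _ _
    · exact (min_le_left _ _).trans (h w hw0 (mt mnorm_eq_zero.2 hw))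
  have low : (∃ c : ℝ, 0 < c ∧ ∀ w : List (Fin k), w ≠ [] → wordProd M w ≠ 0 →
      mnorm (wordProd M w) ≤ c) →
      ∃ c : ℝ, 0 < c ∧ ∀ w, wordProd M w ≠ 0 → c ≤ mnorm (wordProd M w) := by
    rintro ⟨c, hc, h⟩
    obtain ⟨c', hc', h'⟩ := hf.bounded_below_of_bounded hS hl hent
      (lt_max_of_lt_left hc : 0 < max c (mnorm (wordProd M []))) fun w => by
        by_cases hw0 : w = []
        · exact hw0 ▸ le_max_right _ _
        by_cases hw : wordProd M w = 0
        · rw [mnorm_eq_zero.2 hw]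
          exact (lt_max_of_lt_left hc).le
        · exact (h w hw0 hw).trans (le_max_left _ _)
    exact ⟨c', hc', fun w hw => h' w (mt mnorm_eq_zero.1 hw)⟩
  refine ⟨⟨fun h => ?_, fun h => ?_⟩, fun h => ?_, ?_⟩
  · obtain ⟨C, hC, h'⟩ := up h
    exact ⟨C, hC, fun w _ _ => h' w⟩
  · obtain ⟨c, hc, h'⟩ := low h
    exact ⟨c, hc, fun w _ => h' w⟩
  · obtain ⟨c, hc, h'⟩ := low h
    obtain ⟨C, hC, h⟩ := h
    refine ⟨max C c⁻¹, lt_max_of_lt_left hC, fun w hw hw0 =>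
      ⟨?_, (h w hw hw0).trans (le_max_left _ _)⟩⟩
    exact (inv_le_of_inv_le₀ hc (le_max_right _ _)).trans (h' w hw0)
  · rintro ⟨C, hC, h⟩
    exact ⟨C, hC, fun w hw hw0 => (h w hw hw0).2⟩
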